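/- Let $A$ be a complete local noetherian commutative ring and $B$ a flat $A$-module. Then $\mathrm{Ext}^p_A(B, M) = 0$ for all $p \ge 1$ and all finitely generated $A$-modules $M$. -/

import Mathlib

open CategoryTheory

namespace Module.Flat

variable {R F : Type*} [CommRing R] [AddCommGroup F] [Module R F]

/-- A submodule with flat quotient is pure: it meets `I • F` in `I • K`. -/
theorem smul_top_inf_le_of_flat_quotient (K : Submodule R F) [Flat R (F ⧸ K)] (I : Ideal R) :
    (I • ⊤ : Submodule R F) ⊓ K ≤ I • K := by
  rintro x ⟨hxI, hxK⟩
  rw [← Submodule.span_univ, ← Set.range_id, SetLike.mem_coe,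
    Submodule.mem_ideal_smul_span_iff_exists_sum] at hxI
  obtain ⟨a, ha, rfl⟩ := hxI
  have h0 : ∑ i : a.support, a i.1 • K.mkQ i.1 = 0 := by
    have := (Submodule.Quotient.mk_eq_zero K).2 hxK
    rw [← Submodule.mkQ_apply, Finsupp.sum, ← Finset.sum_coe_sort, map_sum] at this
    simpa using this
  obtain ⟨k, b, y, hy, hb⟩ := isTrivialRelation_of_sum_smul_eq_zero h0
  choose z hz using fun j ↦ K.mkQ_surjective (y j)
  have key : a.sum (fun i c ↦ c • id i) =
      ∑ i : a.support, a i.1 • ((i.1 : F) - ∑ j, b i j • z j) := by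
    simp only [smul_sub, Finset.sum_sub_distrib, Finset.smul_sum, smul_smul]
    rw [Finset.sum_comm (s := Finset.univ (α := a.support))]
    simp only [← Finset.sum_smul, hb, zero_smul, Finset.sum_const_zero, sub_zero]
    rw [Finsupp.sum, ← Finset.sum_coe_sort]
    simp
  rw [key]
  refine Submodule.sum_mem _ fun i _ ↦ Submodule.smul_mem_smul (ha i) ?_
  rw [← Submodule.Quotient.mk_eq_zero K, ← Submodule.mkQ_apply, map_sub, map_sum,
    show K.mkQ i.1 = _ from hy i]
  simp [hz]

/-- A submodule of a flat module with flat quotient is flat. -/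
theorem of_flat_quotient [Flat R F] (K : Submodule R F) [Flat R (F ⧸ K)] : Flat R K := by
  refine of_forall_isTrivialRelation fun {l f x} h ↦ ?_
  have h' : ∑ i, f i • (x i : F) = 0 := by simpa using congr(K.subtype $h)
  obtain ⟨m, a, y, hy, ha⟩ := isTrivialRelation_of_sum_smul_eq_zero h'
  have hc : (Fintype.linearCombination R (K.mkQ ∘ y)) ∘ₗ
      (Fintype.linearCombination R a) = 0 := by
    refine LinearMap.pi_ext' fun i ↦ LinearMap.ext_ring ?_
    have : K.mkQ (x i) = 0 := by simp
    rw [show (x i : F) = _ from hy i] at this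
    simpa [Fintype.linearCombination_apply] using this
  obtain ⟨k, c, z, hz, hca⟩ := exists_factorization_of_comp_eq_zero_of_free hc
  obtain ⟨w, hw⟩ := projective_lifting_property K.mkQ z K.mkQ_surjective
  have hmem (j) : y j - w (c (Pi.single j 1)) ∈ K := by
    rw [← Submodule.Quotient.mk_eq_zero K, ← Submodule.mkQ_apply, map_sub,
      ← LinearMap.comp_apply K.mkQ w, hw, ← LinearMap.comp_apply z c, ← hz]
    simp [Fintype.linearCombination_apply_single]
  refine ⟨m, a, fun j ↦ ⟨_, hmem j⟩, fun i ↦ Subtype.ext ?_, ha⟩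
  have hai : a i = ∑ j, a i j • (Pi.single j 1 : Fin m → R) := by
    ext j; simp [Finset.sum_apply, Pi.single_apply]
  have hcai : c (a i) = 0 := by
    simpa [Fintype.linearCombination_apply_single] using congr($hca (Pi.single i 1))
  rw [hai, map_sum] at hcai
  have := congr(w $hcai)
  simp only [map_sum, map_smul, map_zero] at this
  simp [smul_sub, ← hy i, this]

end Module.Flat

section

variable {R F : Type*} [CommRing R] [AddCommGroup F] [Module R F]

/-- If `F ⧸ K` is flat and `I` is maximal, then `K ⧸ I • K` is a retract of `F ⧸ I • F`. -/
theorem Submodule.exists_extend_mkQ_of_flat_quotient (K : Submodule R F) [Module.Flat R (F ⧸ K)]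
    (I : Ideal R) [I.IsMaximal] :
    ∃ r : F →ₗ[R] K ⧸ (I • ⊤ : Submodule R K), ∀ x : K, r x = Submodule.Quotient.mk x := by
  let := Ideal.Quotient.field I
  let j : (K ⧸ (I • ⊤ : Submodule R K)) →ₗ[R] F ⧸ (I • ⊤ : Submodule R F) :=
    Submodule.mapQ _ _ K.subtype (by
      rw [← Submodule.map_le_iff_le_comap, Submodule.map_smul'']
      exact Submodule.smul_mono le_rfl le_top)
  let j' := j.extendScalarsOfSurjective (S := R ⧸ I) Ideal.Quotient.mk_surjective
  have hj : LinearMap.ker j' = ⊥ := by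
    refine LinearMap.ker_eq_bot'.2 fun q hq ↦ ?_
    obtain ⟨x, rfl⟩ := Submodule.mkQ_surjective _ q
    have hx : (x : F) ∈ (I • ⊤ : Submodule R F) := by
      rw [← Submodule.Quotient.mk_eq_zero]
      exact hq
    have := Module.Flat.smul_top_inf_le_of_flat_quotient K I ⟨hx, x.2⟩
    rw [Submodule.mkQ_apply, Submodule.Quotient.mk_eq_zero, Submodule.mem_smul_top_iff]
    exact this
  obtain ⟨s, hs⟩ := j'.exists_leftInverse_of_injective hj
  exact ⟨s.restrictScalars R ∘ₗ Submodule.mkQ _, fun x ↦ congr($hs (Submodule.Quotient.mk x))⟩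

variable {M : Type*} [AddCommGroup M] [Module R M]

/-- A linear map on a pure submodule of a projective module extends modulo a maximal ideal. -/
theorem LinearMap.exists_sub_mem_smul_top_of_flat_quotient [Module.Projective R F]
    (K : Submodule R F) [Module.Flat R (F ⧸ K)] (I : Ideal R) [I.IsMaximal] (f : K →ₗ[R] M) :
    ∃ g : F →ₗ[R] M, ∀ x : K, f x - g x ∈ (I • ⊤ : Submodule R M) := by
  obtain ⟨r, hr⟩ := K.exists_extend_mkQ_of_flat_quotient I
  let q : (K ⧸ (I • ⊤ : Submodule R K)) →ₗ[R] M ⧸ (I • ⊤ : Submodule R M) :=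
    Submodule.mapQ _ _ f (by
      rw [← Submodule.map_le_iff_le_comap, Submodule.map_smul'']
      exact Submodule.smul_mono le_rfl le_top)
  obtain ⟨g, hg⟩ := Module.projective_lifting_property (Submodule.mkQ _) (q ∘ₗ r)
    (Submodule.mkQ_surjective _)
  refine ⟨g, fun x ↦ ?_⟩
  rw [← Submodule.Quotient.eq]
  have := congr($hg x)
  simp only [LinearMap.comp_apply, hr] at this
  exact this.symm

/-- Successive approximation step for extending a linear map from a pure submodule. -/
theorem LinearMap.exists_sub_mem_pow_succ_smul_top_of_flat_quotient [Module.Projective R F]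
    (K : Submodule R F) [Module.Flat R (F ⧸ K)] (I : Ideal R) [I.IsMaximal] (f : K →ₗ[R] M)
    (n : ℕ) (g : F →ₗ[R] M) (hg : ∀ x : K, f x - g x ∈ (I ^ n • ⊤ : Submodule R M)) :
    ∃ g' : F →ₗ[R] M, (∀ x : K, f x - g' x ∈ (I ^ (n + 1) • ⊤ : Submodule R M)) ∧
      ∀ y, g y - g' y ∈ (I ^ n • ⊤ : Submodule R M) := by
  let e : K →ₗ[R] (I ^ n • ⊤ : Submodule R M) := (f - g ∘ₗ K.subtype).codRestrict _ hg
  obtain ⟨d, hd⟩ := exists_sub_mem_smul_top_of_flat_quotient K I e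
  refine ⟨g + Submodule.subtype _ ∘ₗ d, fun x ↦ ?_, fun y ↦ by simp⟩
  have : f x - g x - d x ∈ I • (I ^ n • ⊤ : Submodule R M) :=
    (Submodule.mem_smul_top_iff _ _ _).1 (hd x)
  rw [← mul_smul, ← pow_succ'] at this
  simpa [sub_sub] using this

/-- A linear map from a pure submodule of a projective module to an `I`-adically complete module
extends, when `I` is maximal. -/
theorem LinearMap.exists_extend_of_flat_quotient_of_isAdicComplete [Module.Projective R F]
    (K : Submodule R F) [Module.Flat R (F ⧸ K)] (I : Ideal R) [I.IsMaximal] [IsAdicComplete I M]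
    (f : K →ₗ[R] M) : ∃ g : F →ₗ[R] M, g ∘ₗ K.subtype = f := by
  choose! next hnext hsub using
    fun n ↦ exists_sub_mem_pow_succ_smul_top_of_flat_quotient K I f n
  let g : ℕ → F →ₗ[R] M := fun n ↦ n.rec 0 next
  have hg (n : ℕ) : ∀ x : K, f x - g n x ∈ (I ^ n • ⊤ : Submodule R M) := by
    induction n with
    | zero => simp
    | succ n ih => exact hnext n (g n) ih
  have hcompat {m n : ℕ} (hmn : m ≤ n) (y : F) :
      (Submodule.Quotient.mk (g n y) : M ⧸ (I ^ m • ⊤ : Submodule R M)) =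
        Submodule.Quotient.mk (g m y) := by
    induction n, hmn using Nat.le_induction with
    | base => rfl
    | succ n hmn ih =>
      rw [← ih, eq_comm, Submodule.Quotient.eq]
      exact Submodule.smul_mono_left (Ideal.pow_le_pow_right hmn) (hsub n (g n) (hg n) y)
  have h {m n : ℕ} (hmn : m ≤ n) :
      Submodule.factorPow I M hmn ∘ₗ (Submodule.mkQ (I ^ n • ⊤) ∘ₗ g n) =
        Submodule.mkQ (I ^ m • ⊤) ∘ₗ g m :=
    LinearMap.ext fun y ↦ hcompat hmn y
  refine ⟨IsAdicComplete.lift I (fun n ↦ Submodule.mkQ (I ^ n • ⊤) ∘ₗ g n) h,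
    LinearMap.ext fun x ↦ (IsHausdorff.eq_iff_smodEq (I := I)).2 fun n ↦ ?_⟩
  refine (IsAdicComplete.mk_lift I h n (x : F)).trans ?_
  exact ((Submodule.Quotient.eq _).2 (hg n x)).symm

end

/-- A finite module over a noetherian local ring, complete for its maximal ideal, is complete. -/
theorem IsAdicComplete.of_finite_of_isLocalRing (A M : Type*) [CommRing A] [IsNoetherianRing A]
    [IsLocalRing A] [IsAdicComplete (IsLocalRing.maximalIdeal A) A] [AddCommGroup M] [Module A M]
    [Module.Finite A M] : IsAdicComplete (IsLocalRing.maximalIdeal A) M where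
  toIsHausdorff := inferInstance
  toIsPrecomplete := by
    rw [← AdicCompletion.of_surjective_iff]
    intro y
    obtain ⟨t, rfl⟩ := AdicCompletion.ofTensorProduct_surjective_of_finite _ M y
    induction t with
    | zero => exact ⟨0, by simp⟩
    | add a b ha hb =>
      obtain ⟨⟨a', ha⟩, b', hb⟩ := ha, hb
      exact ⟨a' + b', by simp [ha, hb]⟩
    | tmul r m =>
      obtain ⟨a, rfl⟩ := AdicCompletion.of_surjective (IsLocalRing.maximalIdeal A) A r
      refine ⟨a • m, ?_⟩
      rw [AdicCompletion.ofTensorProduct_tmul, map_smul]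
      exact (algebraMap_smul (AdicCompletion _ A) a _).symm

namespace CategoryTheory.ProjectiveResolution

universe u

variable {R : Type u} [CommRing R] {B : ModuleCat.{u} R} (P : ProjectiveResolution B)

/-- The cokernels of the differentials in a projective resolution of a flat module are flat. -/
theorem flat_quotient_range_d [Module.Flat R B] (n : ℕ) :
    Module.Flat R (P.complex.X n ⧸ LinearMap.range (P.complex.d (n + 1) n).hom) := by
  induction n with
  | zero =>
    have hex := (ShortComplex.moduleCat_exact_iff_range_eq_ker _).1
      (ShortComplex.exact_of_g_is_cokernel (ShortComplex.mk _ _ P.complex_d_comp_π_f_zero)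
        P.isColimitCokernelCofork)
    dsimp at hex
    rw [hex]
    let π : P.complex.X 0 →ₗ[R] B := (P.π.f 0).hom
    have hs : Function.Surjective π := (ModuleCat.epi_iff_surjective (P.π.f 0)).1 inferInstance
    exact Module.Flat.of_linearEquiv (π.quotKerEquivOfSurjective hs)
  | succ n ih =>
    have : Module.Projective R (P.complex.X n) :=
      (_root_.IsProjective.iff_projective (R := R) _).2 (P.projective n)
    have := Module.Flat.of_flat_quotient (LinearMap.range (P.complex.d (n + 1) n).hom)
    have hex := (ShortComplex.moduleCat_exact_iff_range_eq_ker _).1 (P.exact_succ n)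
    dsimp at hex
    rw [hex]
    exact Module.Flat.of_linearEquiv (LinearMap.quotKerEquivRange _)

end CategoryTheory.ProjectiveResolution

theorem ext_eq_zero_of_flat_of_finite_over_complete_local (A : Type) [CommRing A]
    [IsNoetherianRing A] [IsLocalRing A] [IsAdicComplete (IsLocalRing.maximalIdeal A) A]
    (B : Type) [AddCommGroup B] [Module A B] [Module.Flat A B]
    (M : Type) [AddCommGroup M] [Module A M] [Module.Finite A M]
    (p : ℕ) (hp : 1 ≤ p) :
    Subsingleton (((Ext A (ModuleCat A) p).obj
      (Opposite.op (ModuleCat.of A B))).obj (ModuleCat.of A M)) := by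
  obtain ⟨n, rfl⟩ := Nat.exists_eq_add_of_le' hp
  have := IsAdicComplete.of_finite_of_isLocalRing A M
  let P := ProjectiveResolution.of (ModuleCat.of A B)
  have hflat := P.flat_quotient_range_d n
  rw [← ModuleCat.isZero_iff_subsingleton]
  refine Limits.IsZero.of_iso ?_ (P.isoExt (n + 1) (ModuleCat.of A M))
  rw [← HomologicalComplex.exactAt_iff_isZero_homology,
    HomologicalComplex.exactAt_iff' _ n (n + 1) (n + 2) (by simp) (by simp),
    ShortComplex.moduleCat_exact_iff]
  intro (f : P.complex.X (n + 1) ⟶ ModuleCat.of A M) (hf : P.complex.d (n + 2) (n + 1) ≫ f = 0)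
  have : Module.Projective A (P.complex.X n) :=
    (IsProjective.iff_projective (R := A) _).2 (P.projective n)
  let d := (P.complex.d (n + 1) n).hom
  have hker : LinearMap.ker d ≤ LinearMap.ker f.hom := by
    rw [← (ShortComplex.moduleCat_exact_iff_range_eq_ker _).1 (P.exact_succ n)]
    rintro _ ⟨x, rfl⟩
    exact congr($hf x)
  let e : LinearMap.range d →ₗ[A] M :=
    (LinearMap.ker d).liftQ f.hom hker ∘ₗ d.quotKerEquivRange.symm.toLinearMap
  obtain ⟨g, hg⟩ := LinearMap.exists_extend_of_flat_quotient_of_isAdicComplete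
    (LinearMap.range d) (IsLocalRing.maximalIdeal A) e
  refine ⟨ModuleCat.ofHom g, ?_⟩
  change P.complex.d (n + 1) n ≫ ModuleCat.ofHom g = f
  ext x
  have hx : d.quotKerEquivRange.symm ⟨d x, x, rfl⟩ = Submodule.Quotient.mk x := by
    rw [LinearEquiv.symm_apply_eq]
    rfl
  have := congr($hg ⟨d x, x, rfl⟩)
  simpa [e, hx, d] using this
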